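/- Let H be a real N×L matrix and G a real N×M matrix with rank of G equal to M, and let Γ be a real (N−M)×N matrix with rank N−M satisfying Γ G = 0. Then Hᵀ Γᵀ (Γ Γᵀ)⁻¹ Γ H = Hᵀ P_G^⊥ H, where P_G^⊥ = I_N − G (Gᵀ G)⁻¹ Gᵀ; that is, the (scaled) Fisher information about x retained by the whitened differential observation set equals that of the projected model, so the differencing process incurs no information loss. -/

import Mathlib

open Matrix

namespace Matrix

/-- A square matrix over a field whose rank equals its size is invertible. -/
lemma isUnit_det_of_rank_eq_card {K n : Type*} [Field K] [Fintype n] [DecidableEq n]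
    {A : Matrix n n K} (hA : A.rank = Fintype.card n) : IsUnit A.det := by
  rw [← isUnit_iff_isUnit_det, ← mulVec_surjective_iff_isUnit]
  have h : LinearMap.range A.mulVecLin = ⊤ :=
    Submodule.eq_top_of_finrank_eq (by rw [Module.finrank_fintype_fun_eq_card]; exact hA)
  exact LinearMap.range_eq_top.mp h

/-- If the rows of `B` and the columns of `A` are bases of complementary orthogonal subspaces, the
orthogonal projectors onto these subspaces add up to the identity. -/
lemma rowSpace_projector_add_columnSpace_projector {K m n k : Type*} [Field K] [LinearOrder K]
    [IsStrictOrderedRing K] [Fintype m] [DecidableEq m] [Fintype n] [DecidableEq n] [Fintype k]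
    [DecidableEq k] (e : n ≃ k ⊕ m) {A : Matrix n m K} {B : Matrix k n K}
    (hA : A.rank = Fintype.card m) (hB : B.rank = Fintype.card k) (hBA : B * A = 0) :
    Bᵀ * (B * Bᵀ)⁻¹ * B + A * (Aᵀ * A)⁻¹ * Aᵀ = 1 := by
  have hAu : IsUnit (Aᵀ * A).det :=
    isUnit_det_of_rank_eq_card (by rw [rank_transpose_mul_self, hA])
  have hBu : IsUnit (B * Bᵀ).det :=
    isUnit_det_of_rank_eq_card (by rw [rank_self_mul_transpose, hB])
  have hAB : Aᵀ * Bᵀ = 0 := by rw [← transpose_mul, hBA, transpose_zero]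
  rw [← fromCols_mul_fromRows, fromCols_mul_fromRows_eq_one_comm e, fromRows_mul_fromCols]
  simp only [← Matrix.mul_assoc, mul_nonsing_inv _ hAu, mul_nonsing_inv _ hBu, hBA, hAB,
    Matrix.zero_mul, fromBlocks_one]

end Matrix

theorem differencing_no_information_loss (N L M : ℕ) (hMN : M < N)
    (H : Matrix (Fin N) (Fin L) ℝ) (G : Matrix (Fin N) (Fin M) ℝ)
    (hG : G.rank = M)
    (Γ : Matrix (Fin (N - M)) (Fin N) ℝ)
    (hΓrank : Γ.rank = N - M) (hΓG : Γ * G = 0) :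
    Hᵀ * (Γᵀ * (Γ * Γᵀ)⁻¹ * Γ) * H
      = Hᵀ * ((1 : Matrix (Fin N) (Fin N) ℝ) - G * (Gᵀ * G)⁻¹ * Gᵀ) * H := by
  have e : Fin N ≃ Fin (N - M) ⊕ Fin M :=
    (finCongr (Nat.sub_add_cancel hMN.le).symm).trans finSumFinEquiv.symm
  rw [eq_sub_of_add_eq (rowSpace_projector_add_columnSpace_projector e
    (by simpa using hG) (by simpa using hΓrank) hΓG)]
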